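/- (Inversion of the RQLCT.) Let A₁ = (a₁ b₁; c₁ d₁) and A₂ = (a₂ b₂; c₂ d₂) be real 2×2 matrices with det A₁ = det A₂ = 1 and b₁, b₂ ≠ 0. If f ∈ L¹(ℝ²,ℍ) and ℒ_r f ∈ L¹(ℝ²,ℍ), then f(x₁,x₂) = ∫_{ℝ²} (ℒ_r f)(ω₁,ω₂) K_{A₂^{-1}}^j(ω₂,x₂) K_{A₁^{-1}}^i(ω₁,x₁) dω₁ dω₂ for almost every (x₁,x₂) ∈ ℝ², where A^{-1} = (d −b; −c a) for A = (a b; c d) with det A = 1. -/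

import Mathlib

open MeasureTheory Real ENNReal

noncomputable section

/-- The real quaternions. -/
abbrev Hq := Quaternion ℝ

/-- The imaginary unit `i`. -/
def qi : Hq := ⟨0,1,0,0⟩
/-- The imaginary unit `j`. -/
def qj : Hq := ⟨0,0,1,0⟩
/-- The imaginary unit `k`. -/
def qk : Hq := ⟨0,0,0,1⟩

/-- For a (unit pure imaginary) quaternion `u`, `e^{uθ} := cos θ + u sin θ`. -/
def qexp (u : Hq) (θ : ℝ) : Hq := (Real.cos θ) • (1 : Hq) + (Real.sin θ) • u

/-- The right-sided quaternion Fourier transform of `f ∈ L¹(ℝ²,ℍ)`. -/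
def Fr (f : ℝ × ℝ → Hq) (ω : ℝ × ℝ) : Hq :=
  (1 / (2 * Real.pi)) • ∫ x : ℝ × ℝ, f x * qexp qi (-(ω.1 * x.1)) * qexp qj (-(ω.2 * x.2))

/-- The two-sided quaternion Fourier transform of `f ∈ L¹(ℝ²,ℍ)`. -/
def Fs (f : ℝ × ℝ → Hq) (ω : ℝ × ℝ) : Hq :=
  (1 / (2 * Real.pi)) • ∫ x : ℝ × ℝ, qexp qi (-(ω.1 * x.1)) * f x * qexp qj (-(ω.2 * x.2))


/-- The LCT kernel K_A^u for a matrix A = (a b; c d) with b ≠ 0, evaluated at (x, ω). -/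
def Kker (u : Hq) (a b d : ℝ) (x ω : ℝ) : Hq :=
  (Real.sqrt (2 * Real.pi * |b|))⁻¹ •
    (qexp u (-(Real.pi * Real.sign b / 4)) *
      qexp u (a * x ^ 2 / (2 * b) - x * ω / b + d * ω ^ 2 / (2 * b)))

/-- The two-sided quaternion linear canonical transform (case b₁, b₂ ≠ 0). -/
def Ls (a1 b1 d1 a2 b2 d2 : ℝ) (f : ℝ × ℝ → Hq) (ω : ℝ × ℝ) : Hq :=
  ∫ x : ℝ × ℝ, Kker qi a1 b1 d1 x.1 ω.1 * f x * Kker qj a2 b2 d2 x.2 ω.2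

/-- The right-sided quaternion linear canonical transform (case b₁, b₂ ≠ 0). -/
def Lr (a1 b1 d1 a2 b2 d2 : ℝ) (f : ℝ × ℝ → Hq) (ω : ℝ × ℝ) : Hq :=
  ∫ x : ℝ × ℝ, f x * Kker qi a1 b1 d1 x.1 ω.1 * Kker qj a2 b2 d2 x.2 ω.2

open scoped FourierTransform in
lemma ae_inv (f : ℝ → ℂ) (hf : Integrable f) (hF : Integrable (𝓕 f)) :
    ∀ᵐ x, 𝓕⁻ (𝓕 f) x = f x := by
  have hc : Continuous (𝓕⁻ (𝓕 f)) := by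
    rw [Real.fourierInv_eq_fourier_comp_neg]
    exact VectorFourier.fourierIntegral_continuous Real.continuous_fourierChar
      (by exact continuous_inner) hF.comp_neg
  have swap : ∀ (p q : ℝ → ℂ), Integrable p → Integrable q →
      ∫ x, 𝓕 p x * q x = ∫ x, p x * 𝓕 q x := by
    intro p q hp hq
    simpa using! (VectorFourier.integral_fourierIntegral_smul_eq_flip (L := innerₗ ℝ)
      Real.continuous_fourierChar (by exact continuous_inner) hp hq)
  refine ae_eq_of_integral_contDiff_smul_eq hc.locallyIntegrable hf.locallyIntegrable ?_
  intro g hg hgc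
  have hg' : ContDiff ℝ (⊤ : ℕ∞) (fun x => (g x : ℂ)) := Complex.ofRealCLM.contDiff.comp hg
  have hgc' : HasCompactSupport (fun x => (g x : ℂ)) := hgc.comp_left (g := fun x : ℝ => (x : ℂ)) (by simp)
  let φ : SchwartzMap ℝ ℂ := hgc'.toSchwartzMap hg'
  have hφ : ∀ x, φ x = (g x : ℂ) := fun x => rfl
  have hφi : Integrable (φ : ℝ → ℂ) := φ.integrable
  have hinv : 𝓕 (𝓕⁻ (φ : ℝ → ℂ)) = φ := by
    rw [← SchwartzMap.fourierInv_coe, ← SchwartzMap.fourier_coe, FourierTransform.fourier_fourierInv_eq]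
  have hφF : Integrable (𝓕⁻ (φ : ℝ → ℂ)) := by
    rw [← SchwartzMap.fourierInv_coe]; exact SchwartzMap.integrable _
  have e1 : ∫ x, 𝓕⁻ (𝓕 f) x * φ x = ∫ x, 𝓕 f x * 𝓕⁻ (φ : ℝ → ℂ) x := by
    rw [Real.fourierInv_eq_fourier_comp_neg (φ : ℝ → ℂ), ← swap _ _ hF hφi.comp_neg,
      ← integral_neg_eq_self]
    simp [Real.fourierInv_eq_fourier_neg]
  rw [swap _ _ hf hφF, hinv] at e1
  simpa [hφ, mul_comm] using e1

/-- complex kernel -/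
def kc (a b d x ω : ℝ) : ℂ :=
  ((Real.sqrt (2 * Real.pi * |b|))⁻¹ : ℝ) *
    (Complex.exp ((-(Real.pi * Real.sign b / 4) : ℝ) * Complex.I) *
      Complex.exp ((a * x ^ 2 / (2 * b) - x * ω / b + d * ω ^ 2 / (2 * b) : ℝ) * Complex.I))

open scoped FourierTransform in
lemma inv1C (a b d : ℝ) (hb : b ≠ 0) (f : ℝ → ℂ) (hf : Integrable f)
    (hL : Integrable (fun ω => ∫ x, f x * kc a b d x ω)) :
    ∀ᵐ x, f x = ∫ ω, (∫ y, f y * kc a b d y ω) * kc d (-b) a ω x := by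
  let ch : ℝ → ℝ → ℂ := fun s x => Complex.exp ((s * x ^ 2 / (2 * b) : ℝ) * Complex.I)
  let C : ℂ := ((Real.sqrt (2 * Real.pi * |b|))⁻¹ : ℝ) *
    (Complex.exp ((-(Real.pi * Real.sign b / 4) : ℝ) * Complex.I))
  let C' : ℂ := ((Real.sqrt (2 * Real.pi * |b|))⁻¹ : ℝ) *
    (Complex.exp (((Real.pi * Real.sign b / 4) : ℝ) * Complex.I))
  have hch : ∀ s x, ch s x * ch (-s) x = 1 := by
    intro s x
    simp only [ch]
    rw [← Complex.exp_add, ← Complex.exp_zero]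
    congr 1
    push_cast; ring
  have hpos : 0 < 2 * Real.pi * |b| := by positivity
  have hCC : C * C' * (2 * Real.pi * |b| : ℝ) = 1 := by
    have h1 : Complex.exp ((-(Real.pi * Real.sign b / 4) : ℝ) * Complex.I) *
        Complex.exp (((Real.pi * Real.sign b / 4) : ℝ) * Complex.I) = 1 := by
      rw [← Complex.exp_add, ← Complex.exp_zero]
      congr 1
      push_cast; ring
    have h2 : (Real.sqrt (2 * Real.pi * |b|))⁻¹ * (Real.sqrt (2 * Real.pi * |b|))⁻¹ *
        (2 * Real.pi * |b|) = 1 := by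
      rw [← mul_inv, Real.mul_self_sqrt hpos.le, inv_mul_cancel₀ hpos.ne']
    have h3 := congrArg (fun r : ℝ => (r : ℂ)) h2
    simp only [Complex.ofReal_mul, Complex.ofReal_one] at h3
    simp only [C, C', Complex.ofReal_mul]
    linear_combination ((((Real.sqrt (2 * Real.pi * |b|))⁻¹ : ℝ) : ℂ) * (((Real.sqrt (2 * Real.pi * |b|))⁻¹ : ℝ) : ℂ) *
      (((2 : ℝ) : ℂ) * (Real.pi : ℂ) * ((|b| : ℝ) : ℂ))) * h1 + h3
  have hC0 : C ≠ 0 := by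
    intro h; rw [h] at hCC; simp at hCC
  let g : ℝ → ℂ := fun x => f x * ch a x
  have hgi : Integrable g := by
    refine hf.mul_bdd (c := 1) ?_ ?_
    · apply Continuous.aestronglyMeasurable; fun_prop
    · exact Filter.Eventually.of_forall fun x => (Complex.norm_exp_ofReal_mul_I _).le
  have hk : ∀ x ω, kc a b d x ω =
      C * ch d ω * (ch a x * Complex.exp ((-2 * Real.pi * x * (ω / (2 * Real.pi * b)) : ℝ) * Complex.I)) := by
    intro x ω
    simp only [kc, C, ch]
    have : ((a * x ^ 2 / (2 * b) - x * ω / b + d * ω ^ 2 / (2 * b) : ℝ) : ℂ) * Complex.I =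
      ((d * ω ^ 2 / (2 * b) : ℝ) : ℂ) * Complex.I + (((a * x ^ 2 / (2 * b) : ℝ) : ℂ) * Complex.I +
        ((-2 * Real.pi * x * (ω / (2 * Real.pi * b)) : ℝ) : ℂ) * Complex.I) := by
      rw [← add_mul, ← add_mul, ← Complex.ofReal_add, ← Complex.ofReal_add]
      congr 2
      field_simp
      ring
    rw [this, Complex.exp_add, Complex.exp_add]
    ring
  have hk' : ∀ x ω, kc d (-b) a ω x =
      C' * ch (-d) ω * (ch (-a) x * Complex.exp ((2 * Real.pi * ((ω / (2 * Real.pi * b)) * x) : ℝ) * Complex.I)) := by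
    intro x ω
    simp only [kc, C', ch, abs_neg]
    have : ((d * ω ^ 2 / (2 * -b) - ω * x / -b + a * x ^ 2 / (2 * -b) : ℝ) : ℂ) * Complex.I =
      ((-d * ω ^ 2 / (2 * b) : ℝ) : ℂ) * Complex.I + (((-a * x ^ 2 / (2 * b) : ℝ) : ℂ) * Complex.I +
        ((2 * Real.pi * ((ω / (2 * Real.pi * b)) * x) : ℝ) : ℂ) * Complex.I) := by
      rw [← add_mul, ← add_mul, ← Complex.ofReal_add, ← Complex.ofReal_add]
      congr 2
      field_simp
      ring
    have hs : -(Real.pi * Real.sign (-b) / 4) = Real.pi * Real.sign b / 4 := by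
      rw [Real.sign_neg]; ring
    rw [this, hs, Complex.exp_add, Complex.exp_add]
    ring
  have hLf : ∀ ω, ∫ y, f y * kc a b d y ω = C * ch d ω * 𝓕 g (ω / (2 * Real.pi * b)) := by
    intro ω
    rw [Real.fourier_real_eq_integral_exp_smul, ← integral_const_mul]
    congr 1; ext y
    rw [hk]; simp only [smul_eq_mul, g]; ring
  have hR : 2 * Real.pi * b ≠ 0 := by positivity
  have hFg : Integrable (𝓕 g) := by
    rw [← integrable_comp_div_iff _ hR]
    have : Integrable (fun ω => (∫ y, f y * kc a b d y ω) * (C⁻¹ * ch (-d) ω)) := by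
      refine hL.mul_bdd (c := ‖C⁻¹‖) ?_ ?_
      · apply Continuous.aestronglyMeasurable; fun_prop
      · refine Filter.Eventually.of_forall fun x => ?_
        rw [norm_mul, show ‖ch (-d) x‖ = 1 from Complex.norm_exp_ofReal_mul_I _, mul_one]
    refine this.congr (Filter.Eventually.of_forall fun ω => ?_)
    simp only [hLf]
    linear_combination (𝓕 g (ω / (2 * Real.pi * b))) * (C * C⁻¹ * hch d ω + mul_inv_cancel₀ hC0)
  filter_upwards [ae_inv g hgi hFg] with x hx
  have : ∀ ω, (∫ y, f y * kc a b d y ω) * kc d (-b) a ω x =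
     (C * C' * ch (-a) x) * (fun v => Complex.exp ((2 * Real.pi * (v * x) : ℝ) * Complex.I) • 𝓕 g v) (ω / (2 * Real.pi * b)) := by
    intro ω
    rw [hLf, hk']
    simp only [smul_eq_mul]
    linear_combination (C * C' * ch (-a) x * 𝓕 g (ω / (2 * Real.pi * b)) * Complex.exp ((2 * Real.pi * ((ω / (2 * Real.pi * b)) * x) : ℝ) * Complex.I)) * hch d ω
  simp_rw [this]
  rw [integral_const_mul, Measure.integral_comp_div (fun v => Complex.exp ((2 * Real.pi * (v * x) : ℝ) * Complex.I) • 𝓕 g v)]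
  rw [Real.fourierInv_eq'] at hx
  have e : ∀ v : ℝ, inner ℝ v x = v * x := fun v => by simp [mul_comm]
  simp only [e] at hx
  rw [hx]
  have hab : |2 * Real.pi * b| = 2 * Real.pi * |b| := by
    rw [abs_mul, abs_of_pos (by positivity : 0 < 2 * Real.pi)]
  rw [hab, Complex.real_smul]
  simp only [g]
  linear_combination -(f x * ch a x * ch (-a) x) * hCC - f x * hch a x

def PC1 : Hq →L[ℝ] ℂ := LinearMap.toContinuousLinearMap
  { toFun := fun q => ⟨q.re, q.imI⟩
    map_add' := fun p q => by apply Complex.ext <;> simp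
    map_smul' := fun r q => by apply Complex.ext <;> simp }
def PC2 : Hq →L[ℝ] ℂ := LinearMap.toContinuousLinearMap
  { toFun := fun q => ⟨q.imK, q.imJ⟩
    map_add' := fun p q => by apply Complex.ext <;> simp
    map_smul' := fun r q => by apply Complex.ext <;> simp }
def PC3 : Hq →L[ℝ] ℂ := LinearMap.toContinuousLinearMap
  { toFun := fun q => ⟨q.re, q.imJ⟩
    map_add' := fun p q => by apply Complex.ext <;> simp
    map_smul' := fun r q => by apply Complex.ext <;> simp }
def PC4 : Hq →L[ℝ] ℂ := LinearMap.toContinuousLinearMap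
  { toFun := fun q => ⟨q.imI, q.imK⟩
    map_add' := fun p q => by apply Complex.ext <;> simp
    map_smul' := fun r q => by apply Complex.ext <;> simp }

lemma PC1_apply (q : Hq) : PC1 q = ⟨q.re, q.imI⟩ := rfl
lemma PC2_apply (q : Hq) : PC2 q = ⟨q.imK, q.imJ⟩ := rfl
lemma PC3_apply (q : Hq) : PC3 q = ⟨q.re, q.imJ⟩ := rfl
lemma PC4_apply (q : Hq) : PC4 q = ⟨q.imI, q.imK⟩ := rfl

/-- `P` intertwines right multiplication by `u` with multiplication by `I`. -/
def Good (u : Hq) (P : Hq →L[ℝ] ℂ) : Prop := ∀ q, P (q * u) = P q * Complex.I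

lemma qi_re : qi.re = 0 := rfl
lemma qi_imI : qi.imI = 1 := rfl
lemma qi_imJ : qi.imJ = 0 := rfl
lemma qi_imK : qi.imK = 0 := rfl
lemma qj_re : qj.re = 0 := rfl
lemma qj_imI : qj.imI = 0 := rfl
lemma qj_imJ : qj.imJ = 1 := rfl
lemma qj_imK : qj.imK = 0 := rfl

lemma good1 : Good qi PC1 := fun q => by
  apply Complex.ext <;> simp [PC1_apply, qi_re, qi_imI, qi_imJ, qi_imK]
lemma good2 : Good qi PC2 := fun q => by
  apply Complex.ext <;> simp [PC2_apply, qi_re, qi_imI, qi_imJ, qi_imK]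
lemma good3 : Good qj PC3 := fun q => by
  apply Complex.ext <;> simp [PC3_apply, qj_re, qj_imI, qj_imJ, qj_imK]
lemma good4 : Good qj PC4 := fun q => by
  apply Complex.ext <;> simp [PC4_apply, qj_re, qj_imI, qj_imJ, qj_imK]

lemma Good.qexp {u : Hq} {P : Hq →L[ℝ] ℂ} (h : Good u P) (q : Hq) (θ : ℝ) :
    P (q * qexp u θ) = P q * Complex.exp (θ * Complex.I) := by
  unfold _root_.qexp
  rw [mul_add, mul_smul_comm, mul_smul_comm, map_add, map_smul, map_smul, h, mul_one,
    Complex.exp_mul_I, ← Complex.ofReal_cos, ← Complex.ofReal_sin]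
  simp only [Complex.real_smul]
  ring

lemma Good.kker {u : Hq} {P : Hq →L[ℝ] ℂ} (h : Good u P) (q : Hq) (a b d x ω : ℝ) :
    P (q * Kker u a b d x ω) = P q * kc a b d x ω := by
  unfold Kker kc
  rw [mul_smul_comm, map_smul, ← mul_assoc, h.qexp, h.qexp, Complex.real_smul]
  ring

lemma continuous_qexp (u : Hq) : Continuous (qexp u) := by
  unfold qexp; fun_prop

lemma continuous_Kker_comp {X : Type*} [TopologicalSpace X] (u : Hq) (a b d : ℝ) {g h : X → ℝ}
    (hg : Continuous g) (hh : Continuous h) :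
    Continuous (fun p : X => Kker u a b d (g p) (h p)) := by
  unfold Kker
  have h1 := continuous_qexp u
  have h2 : Continuous (fun p : X => a * g p ^ 2 / (2 * b) - g p * h p / b +
      d * h p ^ 2 / (2 * b)) := by fun_prop
  refine Continuous.const_smul (M := ℝ) ?_ _
  refine Continuous.mul continuous_const ?_
  exact h1.comp h2

lemma norm_qexp_le (u : Hq) (θ : ℝ) : ‖qexp u θ‖ ≤ 1 + ‖u‖ := by
  unfold qexp
  refine (norm_add_le _ _).trans ?_
  rw [norm_smul, norm_smul, norm_one, Real.norm_eq_abs, Real.norm_eq_abs]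
  have := Real.abs_cos_le_one θ
  have := Real.abs_sin_le_one θ
  have := norm_nonneg u
  nlinarith

lemma Kker_bdd (u : Hq) (a b d : ℝ) : ∃ M, ∀ x ω, ‖Kker u a b d x ω‖ ≤ M := by
  refine ⟨‖(Real.sqrt (2 * Real.pi * |b|))⁻¹‖ * ((1 + ‖u‖) * (1 + ‖u‖)), fun x ω => ?_⟩
  unfold Kker
  rw [norm_smul, norm_mul]
  have := norm_nonneg u
  gcongr <;> exact norm_qexp_le _ _

lemma intK {X : Type*} [TopologicalSpace X] [MeasurableSpace X] [OpensMeasurableSpace X]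
    [SecondCountableTopology X] {μ : Measure X}
    (u : Hq) (a b d : ℝ) {f : X → Hq} (hf : Integrable f μ) {g h : X → ℝ}
    (hg : Continuous g) (hh : Continuous h) :
    Integrable (fun p => f p * Kker u a b d (g p) (h p)) μ := by
  obtain ⟨M, hM⟩ := Kker_bdd u a b d
  have hc := (continuous_Kker_comp u a b d hg hh).aestronglyMeasurable (μ := μ)
  refine (hf.norm.mul_const M).mono (hf.1.mul hc) (Filter.Eventually.of_forall fun p => ?_)
  rw [norm_mul]
  refine le_trans ?_ (le_abs_self _)
  gcongr
  exact hM _ _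

lemma invP {u : Hq} {P : Hq →L[ℝ] ℂ} (hP : Good u P) (a b d : ℝ) (hb : b ≠ 0)
    (f : ℝ → Hq) (hf : Integrable f)
    (hL : Integrable (fun ω => ∫ x, f x * Kker u a b d x ω)) :
    ∀ᵐ x, P (f x) = P (∫ ω, (∫ y, f y * Kker u a b d y ω) * Kker u d (-b) a ω x) := by
  have e : ∀ ω, P (∫ x, f x * Kker u a b d x ω) = ∫ x, P (f x) * kc a b d x ω := by
    intro ω
    rw [← P.integral_comp_comm (intK u a b d hf (g := fun x => x) (h := fun _ => ω) continuous_id continuous_const)]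
    simp [hP.kker]
  have h2 : Integrable (fun ω => ∫ x, P (f x) * kc a b d x ω) := by
    simp_rw [← e]; exact P.integrable_comp hL
  filter_upwards [inv1C a b d hb (fun x => P (f x)) (P.integrable_comp hf) h2] with x hx
  rw [hx, ← P.integral_comp_comm (intK u d (-b) a hL (g := fun x => x) (h := fun _ => x) continuous_id continuous_const)]
  simp only [hP.kker, e]

lemma inv_i (a b d : ℝ) (hb : b ≠ 0) (f : ℝ → Hq) (hf : Integrable f)
    (hL : Integrable (fun ω => ∫ x, f x * Kker qi a b d x ω)) :
    ∀ᵐ x, f x = ∫ ω, (∫ y, f y * Kker qi a b d y ω) * Kker qi d (-b) a ω x := by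
  filter_upwards [invP good1 a b d hb f hf hL, invP good2 a b d hb f hf hL] with x h1 h2
  simp only [PC1_apply, PC2_apply, Complex.mk.injEq] at h1 h2
  exact QuaternionAlgebra.ext h1.1 h1.2 h2.2 h2.1

lemma inv_j (a b d : ℝ) (hb : b ≠ 0) (f : ℝ → Hq) (hf : Integrable f)
    (hL : Integrable (fun ω => ∫ x, f x * Kker qj a b d x ω)) :
    ∀ᵐ x, f x = ∫ ω, (∫ y, f y * Kker qj a b d y ω) * Kker qj d (-b) a ω x := by
  filter_upwards [invP good3 a b d hb f hf hL, invP good4 a b d hb f hf hL] with x h1 h2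
  simp only [PC3_apply, PC4_apply, Complex.mk.injEq] at h1 h2
  exact QuaternionAlgebra.ext h1.1 h2.1 h1.2 h2.2

lemma int_mul_K {μ : Measure ℝ} (f : ℝ → Hq) (hf : Integrable f μ) (c : Hq) :
    (∫ x, f x ∂μ) * c = ∫ x, f x * c ∂μ := by
  exact (((ContinuousLinearMap.mul ℝ Hq).flip c).integral_comp_comm hf).symm

lemma main_sm (a1 b1 d1 a2 b2 d2 : ℝ)
    (hb1 : b1 ≠ 0) (hb2 : b2 ≠ 0)
    (f : ℝ × ℝ → Hq) (hfm : StronglyMeasurable f) (hf : Integrable f)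
    (hLf : Integrable (Lr a1 b1 d1 a2 b2 d2 f)) :
    ∀ᵐ x : ℝ × ℝ, f x =
      ∫ ω : ℝ × ℝ, Lr a1 b1 d1 a2 b2 d2 f ω *
        Kker qj d2 (-b2) a2 ω.2 x.2 * Kker qi d1 (-b1) a1 ω.1 x.1 := by
  set F := Lr a1 b1 d1 a2 b2 d2 f with hF
  let h : ℝ × ℝ → Hq := fun p => ∫ y, f (y, p.2) * Kker qi a1 b1 d1 y p.1
  let H : ℝ × ℝ → Hq := fun p => ∫ w, F (p.1, w) * Kker qj d2 (-b2) a2 w p.2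
  have hFm : StronglyMeasurable F := by
    have : StronglyMeasurable (fun q : (ℝ × ℝ) × (ℝ × ℝ) =>
        f q.2 * Kker qi a1 b1 d1 q.2.1 q.1.1 * Kker qj a2 b2 d2 q.2.2 q.1.2) := by
      refine ((hfm.comp_measurable measurable_snd).mul ?_).mul ?_
      · exact (continuous_Kker_comp _ _ _ _ (by fun_prop) (by fun_prop)).stronglyMeasurable
      · exact (continuous_Kker_comp _ _ _ _ (by fun_prop) (by fun_prop)).stronglyMeasurable
    exact this.integral_prod_right'
  have hhm : StronglyMeasurable h := by
    have : StronglyMeasurable (fun q : (ℝ × ℝ) × ℝ =>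
        f (q.2, q.1.2) * Kker qi a1 b1 d1 q.2 q.1.1) := by
      refine (hfm.comp_measurable (by fun_prop)).mul ?_
      exact (continuous_Kker_comp _ _ _ _ (by fun_prop) (by fun_prop)).stronglyMeasurable
    exact this.integral_prod_right'
  have hHm : StronglyMeasurable H := by
    have : StronglyMeasurable (fun q : (ℝ × ℝ) × ℝ =>
        F (q.1.1, q.2) * Kker qj d2 (-b2) a2 q.2 q.1.2) := by
      refine (hFm.comp_measurable (by fun_prop)).mul ?_
      exact (continuous_Kker_comp _ _ _ _ (by fun_prop) (by fun_prop)).stronglyMeasurable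
    exact this.integral_prod_right'
  have hRm : StronglyMeasurable (fun x : ℝ × ℝ => ∫ ω : ℝ × ℝ, F ω *
        Kker qj d2 (-b2) a2 ω.2 x.2 * Kker qi d1 (-b1) a1 ω.1 x.1) := by
    have : StronglyMeasurable (fun q : (ℝ × ℝ) × (ℝ × ℝ) =>
        F q.2 * Kker qj d2 (-b2) a2 q.2.2 q.1.2 * Kker qi d1 (-b1) a1 q.2.1 q.1.1) := by
      refine ((hFm.comp_measurable measurable_snd).mul ?_).mul ?_
      · exact (continuous_Kker_comp _ _ _ _ (by fun_prop) (by fun_prop)).stronglyMeasurable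
      · exact (continuous_Kker_comp _ _ _ _ (by fun_prop) (by fun_prop)).stronglyMeasurable
    exact this.integral_prod_right'
  have hf' : Integrable f ((volume : Measure ℝ).prod volume) := hf
  have hF' : Integrable F ((volume : Measure ℝ).prod volume) := hLf
  have hint1 : ∀ w1 : ℝ, Integrable (fun p : ℝ × ℝ => f p * Kker qi a1 b1 d1 p.1 w1)
      ((volume : Measure ℝ).prod volume) := fun w1 =>
    intK _ _ _ _ hf' continuous_fst continuous_const
  have hFh : ∀ w1 w2 : ℝ, F (w1, w2) = ∫ x2, h (w1, x2) * Kker qj a2 b2 d2 x2 w2 := by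
    intro w1 w2
    have hi : Integrable (fun p : ℝ × ℝ => f p * Kker qi a1 b1 d1 p.1 w1 *
        Kker qj a2 b2 d2 p.2 w2) ((volume : Measure ℝ).prod volume) :=
      intK _ _ _ _ (hint1 w1) continuous_snd continuous_const
    have e1 : F (w1, w2) = ∫ x2, ∫ x1, f (x1, x2) * Kker qi a1 b1 d1 x1 w1 *
        Kker qj a2 b2 d2 x2 w2 := integral_prod_symm _ hi
    rw [e1]
    refine integral_congr_ae ?_
    filter_upwards [(hint1 w1).prod_left_ae] with x2 hx2
    exact (int_mul_K _ hx2 _).symm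
  have hhi : ∀ w1 : ℝ, Integrable (fun x2 => h (w1, x2)) := fun w1 =>
    (hint1 w1).integral_prod_right
  have step1 : ∀ᵐ w1 : ℝ, ∀ᵐ x2 : ℝ, h (w1, x2) = H (w1, x2) := by
    filter_upwards [hF'.prod_right_ae] with w1 hw1
    have e : (fun w2 => F (w1, w2)) = fun w2 => ∫ x2, h (w1, x2) * Kker qj a2 b2 d2 x2 w2 :=
      funext (hFh w1)
    have hw1' : Integrable (fun w2 => ∫ x2, h (w1, x2) * Kker qj a2 b2 d2 x2 w2) := e ▸ hw1
    filter_upwards [inv_j a2 b2 d2 hb2 _ (hhi w1) hw1'] with x2 hx2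
    rw [hx2]
    simp only [H, hFh]
  have step2 : ∀ᵐ x2 : ℝ, ∀ᵐ w1 : ℝ, h (w1, x2) = H (w1, x2) :=
    (Measure.ae_ae_comm (p := fun w1 x2 => h (w1, x2) = H (w1, x2))
      (hhm.measurableSet_eq_fun hHm)).1 step1
  have hint2 : ∀ x2 : ℝ, Integrable (fun p : ℝ × ℝ => F p * Kker qj d2 (-b2) a2 p.2 x2)
      ((volume : Measure ℝ).prod volume) := fun x2 =>
    intK _ _ _ _ hF' continuous_snd continuous_const
  have hHi : ∀ x2 : ℝ, Integrable (fun w1 => H (w1, x2)) := fun x2 =>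
    (hint2 x2).integral_prod_left
  have hR : ∀ x1 x2 : ℝ, ∫ ω : ℝ × ℝ, F ω * Kker qj d2 (-b2) a2 ω.2 x2 *
      Kker qi d1 (-b1) a1 ω.1 x1 = ∫ w1, H (w1, x2) * Kker qi d1 (-b1) a1 w1 x1 := by
    intro x1 x2
    have hi : Integrable (fun p : ℝ × ℝ => F p * Kker qj d2 (-b2) a2 p.2 x2 *
        Kker qi d1 (-b1) a1 p.1 x1) ((volume : Measure ℝ).prod volume) :=
      intK _ _ _ _ (hint2 x2) continuous_fst continuous_const
    refine (integral_prod _ hi).trans ?_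
    refine integral_congr_ae ?_
    filter_upwards [(hint2 x2).prod_right_ae] with w1 hw1
    exact (int_mul_K _ hw1 _).symm
  have step3 : ∀ᵐ x2 : ℝ, ∀ᵐ x1 : ℝ, f (x1, x2) = ∫ ω : ℝ × ℝ, F ω *
      Kker qj d2 (-b2) a2 ω.2 x2 * Kker qi d1 (-b1) a1 ω.1 x1 := by
    filter_upwards [step2, hf'.prod_left_ae] with x2 hx2 hfx2
    have hi : Integrable (fun w1 => h (w1, x2)) := (hHi x2).congr (hx2.mono fun _ e => e.symm)
    filter_upwards [inv_i a1 b1 d1 hb1 (fun x1 => f (x1, x2)) hfx2 hi] with x1 hx1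
    rw [hR, hx1]
    refine integral_congr_ae ?_
    filter_upwards [hx2] with w1 hw1
    rw [← hw1]
  have hms := hfm.measurableSet_eq_fun hRm
  have step4 := (Measure.ae_ae_comm (p := fun x1 x2 => f (x1, x2) = ∫ ω : ℝ × ℝ, F ω *
      Kker qj d2 (-b2) a2 ω.2 x2 * Kker qi d1 (-b1) a1 ω.1 x1) hms).2 step3
  exact (Measure.ae_prod_iff_ae_ae hms).2 step4

theorem stmt17 (a1 b1 c1 d1 a2 b2 c2 d2 : ℝ)
    (hA1 : a1 * d1 - b1 * c1 = 1) (hA2 : a2 * d2 - b2 * c2 = 1)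
    (hb1 : b1 ≠ 0) (hb2 : b2 ≠ 0)
    (f : ℝ × ℝ → Hq) (hf : Integrable f)
    (hLf : Integrable (Lr a1 b1 d1 a2 b2 d2 f)) :
    ∀ᵐ x : ℝ × ℝ, f x =
      ∫ ω : ℝ × ℝ, Lr a1 b1 d1 a2 b2 d2 f ω *
        Kker qj d2 (-b2) a2 ω.2 x.2 * Kker qi d1 (-b1) a1 ω.1 x.1 := by
  obtain ⟨g, hgm, hfg⟩ := hf.1
  have hL : Lr a1 b1 d1 a2 b2 d2 f = Lr a1 b1 d1 a2 b2 d2 g := by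
    funext ω
    refine integral_congr_ae ?_
    filter_upwards [hfg] with x hx
    rw [hx]
  rw [hL] at hLf ⊢
  filter_upwards [hfg, main_sm a1 b1 d1 a2 b2 d2 hb1 hb2 g hgm (hf.congr hfg) hLf] with x hx hx'
  rw [hx, ← hx']
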